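/- Let n be an even positive integer and k ≥ 1 an integer. Let cOpt, cOpt' : ZMod n → Bool be colorings with d_H(cOpt, cOpt') = 1 and |CE(cOpt')| = |CE(cOpt)| (OPT recolors a single node and thereby shifts a cut-edge). Let cOff : ZMod n → Bool satisfy CE(cOff) ⊆ CE(cOpt) and |CE(cOff)| = min(2k, |CE(cOpt)|). Then there exists a coloring cOff' : ZMod n → Bool such that CE(cOff') ⊆ CE(cOpt'), |CE(cOff')| = min(2k, |CE(cOpt')|), and d_H(cOff, cOff') + φ(cOpt', cOff') ≤ 1 + φ(cOpt, cOff). -/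

import Mathlib

/-- The cut-edge set of a coloring `c` of the ring `ZMod n`. -/
def CE {n : ℕ} (c : ZMod n → Bool) : Set (ZMod n) := {i | c i ≠ c (i + 1)}

/-- Hamming distance between two colorings of `ZMod n`. -/
noncomputable def hamDist {n : ℕ} (c c' : ZMod n → Bool) : ℕ :=
  {i : ZMod n | c i ≠ c' i}.ncard

/-- The potential: distance from the coloring of OPT to the nearer of the two
colorings of OFF (up to a swap of color names). -/
noncomputable def pot (n : ℕ) (c c' : ZMod n → Bool) : ℕ :=
  min (hamDist c c') (n - hamDist c c')

/-- Recolor the single node `v`. -/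
def recolor {n : ℕ} (c : ZMod n → Bool) (v : ZMod n) : ZMod n → Bool :=
  Function.update c v (!c v)

/-- Recoloring `v` toggles exactly the two edges at `v`. -/
theorem mem_CE_recolor {n : ℕ} [Fact (1 < n)] (c : ZMod n → Bool) (v i : ZMod n) :
    i ∈ CE (recolor c v) ↔ ((i ∈ CE c) ↔ ¬ (i = v ∨ i + 1 = v)) := by
  have h1 : i + 1 ≠ i := by simp
  simp only [CE, recolor, Set.mem_ofPred_eq, Function.update_apply]
  by_cases h : i = v
  · subst h
    cases c i <;> cases c (i + 1) <;> simp
  · by_cases h' : i + 1 = v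
    · subst h'
      cases c i <;> cases c (i + 1) <;> simp [h1.symm]
    · simp [h, h']

/-- Colorings at Hamming distance one differ by recoloring one node. -/
theorem exists_eq_recolor {n : ℕ} {c c' : ZMod n → Bool} (h : hamDist c c' = 1) :
    ∃ v, c' = recolor c v := by
  obtain ⟨v, hv⟩ := Set.ncard_eq_one.mp h
  refine ⟨v, funext fun i => ?_⟩
  have hi : c i ≠ c' i ↔ i = v := by simpa using Set.ext_iff.mp hv i
  by_cases hiv : i = v
  · subst hiv
    have := hi.mpr rfl
    simp only [recolor, Function.update_self]
    exact Bool.eq_not.mpr this.symm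
  · simp only [recolor, Function.update_of_ne hiv]
    exact (not_not.mp (mt hi.mp hiv)).symm

theorem hamDist_recolor_recolor {n : ℕ} (a b : ZMod n → Bool) (v : ZMod n) :
    hamDist (recolor a v) (recolor b v) = hamDist a b := by
  unfold hamDist
  congr 1
  ext i
  by_cases h : i = v
  · subst h
    simp [recolor]
  · simp [recolor, h]

theorem hamDist_recolor_self {n : ℕ} (c : ZMod n → Bool) (v : ZMod n) :
    hamDist c (recolor c v) = 1 := by
  rw [hamDist, Set.ncard_eq_one]
  refine ⟨v, ?_⟩
  ext i
  by_cases h : i = v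
  · subst h
    simp [recolor]
  · simp [recolor, h]

theorem hamDist_self {n : ℕ} (c : ZMod n → Bool) : hamDist c c = 0 := by
  simp [hamDist]

theorem hamDist_comm {n : ℕ} (a b : ZMod n → Bool) : hamDist a b = hamDist b a := by
  simp only [hamDist, ne_comm]

theorem hamDist_triangle {n : ℕ} [NeZero n] (a b c : ZMod n → Bool) :
    hamDist a c ≤ hamDist a b + hamDist b c := by
  refine (Set.ncard_le_ncard (fun i hi => ?_) (Set.toFinite _)).trans (Set.ncard_union_le _ _)
  by_contra h
  simp only [Set.mem_union, Set.mem_ofPred_eq, not_or, not_not] at h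
  exact hi (h.1.trans h.2)

/-- If recoloring `v` removes the cut-edge `e` but keeps the number of cut-edges, then it
replaces `e` by the other edge at `v`. -/
theorem exists_CE_recolor_exchange {n : ℕ} [Fact (1 < n)] {c : ZMod n → Bool} {v e : ZMod n}
    (hcard : (CE (recolor c v)).ncard = (CE c).ncard) (he : e ∈ CE c)
    (he' : e ∉ CE (recolor c v)) :
    ∃ f, f ∉ CE c ∧ ∀ d : ZMod n → Bool, e ∈ CE d → f ∉ CE d →
      CE (recolor d v) = insert f (CE d \ {e}) := by
  have : NeZero n := ⟨by have := Fact.out (p := 1 < n); omega⟩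
  obtain ⟨f, hf, hfe⟩ : ∃ f, f ∉ CE c ∧ (f = v ∨ f + 1 = v) := by
    by_contra! h
    refine (Set.ncard_lt_ncard (s := CE (recolor c v)) (t := CE c) ?_ (Set.toFinite _)).ne hcard
    refine Set.ssubset_iff_exists.mpr ⟨fun i hi => ?_, e, he, he'⟩
    by_contra hic
    have := h i hic
    rw [mem_CE_recolor] at hi
    tauto
  have hev : e = v ∨ e + 1 = v := by
    rw [mem_CE_recolor] at he'
    tauto
  have hne : e ≠ f := fun h => hf (h ▸ he)
  have hpair : ∀ i, (i = v ∨ i + 1 = v) ↔ (i = e ∨ i = f) := by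
    intro i
    simp only [← eq_sub_iff_add_eq] at *
    grind
  refine ⟨f, hf, fun d hed hfd => Set.ext fun i => ?_⟩
  rw [mem_CE_recolor, hpair]
  simp only [Set.mem_insert_iff, Set.mem_sdiff, Set.mem_singleton_iff]
  grind

theorem off_response_shift (n k : ℕ) (hn : 0 < n) (hne : Even n) (hk : 1 ≤ k)
    (cOpt cOpt' cOff : ZMod n → Bool)
    (hstep : hamDist cOpt cOpt' = 1)
    (hshift : (CE cOpt').ncard = (CE cOpt).ncard)
    (hsub : CE cOff ⊆ CE cOpt)
    (hcard : (CE cOff).ncard = min (2 * k) (CE cOpt).ncard) :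
    ∃ cOff' : ZMod n → Bool,
      CE cOff' ⊆ CE cOpt' ∧
      (CE cOff').ncard = min (2 * k) (CE cOpt').ncard ∧
      hamDist cOff cOff' + pot n cOpt' cOff' ≤ 1 + pot n cOpt cOff := by
  have : NeZero n := ⟨hn.ne'⟩
  have : Fact (1 < n) := ⟨by obtain ⟨m, rfl⟩ := hne; omega⟩
  by_cases hkeep : CE cOff ⊆ CE cOpt'
  · refine ⟨cOff, hkeep, by rw [hshift, hcard], ?_⟩
    have h1 := hamDist_triangle cOpt' cOpt cOff
    have h2 := hamDist_triangle cOpt cOpt' cOff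
    rw [hamDist_comm cOpt' cOpt] at h1
    rw [hamDist_self]
    unfold pot
    omega
  · obtain ⟨v, rfl⟩ := exists_eq_recolor hstep
    obtain ⟨e, he, he'⟩ := Set.not_subset.mp hkeep
    obtain ⟨f, hf, hex⟩ := exists_CE_recolor_exchange hshift (hsub he) he'
    have hfOff : f ∉ CE cOff := fun h => hf (hsub h)
    refine ⟨recolor cOff v, ?_, ?_, ?_⟩
    · rw [hex cOff he hfOff, hex cOpt (hsub he) hf]
      exact Set.insert_subset_insert (Set.sdiff_subset_sdiff_left hsub)
    · rw [hshift, ← hcard, hex cOff he hfOff]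
      exact Set.ncard_exchange hfOff he
    · rw [hamDist_recolor_self, pot, pot, hamDist_recolor_recolor]
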